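/- For a finite set K of finite idempotent similar algebras, the following conditions are equivalent: (a) K has few subproducts; (b) there is a term in the common signature that is an edge term for K (equivalently, the variety generated by K has an edge term); (c) g_K(n) is bounded by a polynomial in n. -/

import Mathlib

/-! Common framework: universal algebras over a fixed signature, terms,
subalgebras, congruences, quotients, edges and their types (Bulatov's
coloured-graph approach), thin edges, connectivity, products, etc. -/

/-- A (functional) signature: a type of operation symbols with arities. -/
structure Signature where
  ops : Type
  arity : ops → ℕ

/-- An algebra of a given signature. -/
structure UAlgebra (σ : Signature) where
  carrier : Type
  interp : ∀ f : σ.ops, (Fin (σ.arity f) → carrier) → carrier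

/-- Terms over the signature `σ` in `n` variables. -/
inductive Term (σ : Signature) (n : ℕ) where
  | var : Fin n → Term σ n
  | app : (f : σ.ops) → (Fin (σ.arity f) → Term σ n) → Term σ n

/-- Evaluation of a term in an algebra; term operations of an algebra are
exactly the operations of the form `Term.eval A t`. -/
def Term.eval {σ : Signature} {n : ℕ} (A : UAlgebra σ) :
    Term σ n → (Fin n → A.carrier) → A.carrier
  | .var i, x => x i
  | .app f ts, x => A.interp f fun j => Term.eval A (ts j) x

namespace UAlgebra

variable {σ : Signature}

/-- An algebra is idempotent if all its basic operations are. -/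
def Idempotent (A : UAlgebra σ) : Prop :=
  ∀ (f : σ.ops) (a : A.carrier), A.interp f (fun _ => a) = a

/-- A set closed under all basic operations. -/
def IsClosed (A : UAlgebra σ) (S : Set A.carrier) : Prop :=
  ∀ (f : σ.ops) (x : Fin (σ.arity f) → A.carrier), (∀ j, x j ∈ S) → A.interp f x ∈ S

/-- Closure of a set under the basic operations. -/
inductive Closure (A : UAlgebra σ) (S : Set A.carrier) : A.carrier → Prop
  | base {a : A.carrier} : a ∈ S → Closure A S a
  | app (f : σ.ops) (x : Fin (σ.arity f) → A.carrier) :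
      (∀ j, Closure A S (x j)) → Closure A S (A.interp f x)

def ClosureSet (A : UAlgebra σ) (S : Set A.carrier) : Set A.carrier := {x | Closure A S x}

theorem closureSet_isClosed (A : UAlgebra σ) (S : Set A.carrier) :
    A.IsClosed (A.ClosureSet S) := fun f x h => Closure.app f x h

/-- The subalgebra of `A` on a closed subset `S`. -/
def subalg (A : UAlgebra σ) (S : Set A.carrier) (hS : A.IsClosed S) : UAlgebra σ where
  carrier := {x : A.carrier // x ∈ S}
  interp f x := ⟨A.interp f fun j => (x j : A.carrier), hS f _ fun j => (x j).2⟩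

/-- The subalgebra generated by a set `S`. -/
def Sg (A : UAlgebra σ) (S : Set A.carrier) : UAlgebra σ :=
  A.subalg (A.ClosureSet S) (A.closureSet_isClosed S)

/-- `a` as an element of `Sg {a, b}`. -/
def sgA (A : UAlgebra σ) (a b : A.carrier) : (A.Sg {a, b}).carrier :=
  ⟨a, Closure.base (Set.mem_insert a {b})⟩

/-- `b` as an element of `Sg {a, b}`. -/
def sgB (A : UAlgebra σ) (a b : A.carrier) : (A.Sg {a, b}).carrier :=
  ⟨b, Closure.base (Set.mem_insert_iff.mpr (Or.inr rfl))⟩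

/-- A congruence of an algebra. -/
structure Congruence (A : UAlgebra σ) where
  rel : A.carrier → A.carrier → Prop
  refl : ∀ x, rel x x
  symm : ∀ {x y}, rel x y → rel y x
  trans : ∀ {x y z}, rel x y → rel y z → rel x z
  compat : ∀ (f : σ.ops) (x y : Fin (σ.arity f) → A.carrier),
      (∀ j, rel (x j) (y j)) → rel (A.interp f x) (A.interp f y)

def Congruence.toSetoid {A : UAlgebra σ} (θ : Congruence A) : Setoid A.carrier :=
  ⟨θ.rel, ⟨θ.refl, θ.symm, θ.trans⟩⟩

/-- The full congruence. -/
def Congruence.IsFull {A : UAlgebra σ} (θ : Congruence A) : Prop := ∀ x y, θ.rel x y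

def Congruence.le {A : UAlgebra σ} (θ η : Congruence A) : Prop :=
  ∀ x y, θ.rel x y → η.rel x y

/-- A maximal congruence: proper, and any congruence above it is full or below it. -/
def Congruence.IsMaximal {A : UAlgebra σ} (θ : Congruence A) : Prop :=
  ¬ θ.IsFull ∧ ∀ η : Congruence A, θ.le η → ¬ η.IsFull → η.le θ

/-- The quotient (factor) algebra. -/
noncomputable def quot (A : UAlgebra σ) (θ : Congruence A) : UAlgebra σ where
  carrier := Quotient θ.toSetoid
  interp f x := Quotient.mk θ.toSetoid (A.interp f fun j => (x j).out)

/-- The class of `a` in the quotient of `Sg {a,b}` by `θ`. -/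
def qa (A : UAlgebra σ) (a b : A.carrier) (θ : Congruence (A.Sg {a, b})) :
    ((A.Sg {a, b}).quot θ).carrier :=
  Quotient.mk θ.toSetoid (A.sgA a b)

def qb (A : UAlgebra σ) (a b : A.carrier) (θ : Congruence (A.Sg {a, b})) :
    ((A.Sg {a, b}).quot θ).carrier :=
  Quotient.mk θ.toSetoid (A.sgB a b)

end UAlgebra

/-- A binary operation is a semilattice operation on a set `B`. -/
def IsSemilatticeOn {α : Type} (f : α → α → α) (B : Set α) : Prop :=
  (∀ x ∈ B, f x x = x) ∧ (∀ x ∈ B, ∀ y ∈ B, f x y = f y x) ∧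
    (∀ x ∈ B, ∀ y ∈ B, ∀ z ∈ B, f x (f y z) = f (f x y) z)

/-- A ternary operation is a majority operation on a set `B`. -/
def IsMajorityOn {α : Type} (g : α → α → α → α) (B : Set α) : Prop :=
  ∀ x ∈ B, ∀ y ∈ B, g x x y = x ∧ g x y x = x ∧ g y x x = x

/-- A ternary operation is a Mal'tsev operation on a set `B`. -/
def IsMaltsevOn {α : Type} (h : α → α → α → α) (B : Set α) : Prop :=
  ∀ x ∈ B, ∀ y ∈ B, h x y y = x ∧ h y y x = x

namespace UAlgebra

variable {σ : Signature}

/-- An algebra is "a set": every term operation is a projection. -/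
def IsSetAlgebra (Q : UAlgebra σ) : Prop :=
  ∀ (n : ℕ) (t : Term σ n), ∃ i : Fin n, ∀ x : Fin n → Q.carrier, t.eval Q x = x i

/-- An algebra is the full idempotent reduct of a module over some finite ring:
its term operations are exactly the idempotent affine combinations; in
particular the affine operation `x - y + z` is a term operation. -/
def IsAffineAlgebra (Q : UAlgebra σ) : Prop :=
  ∃ (R : Type) (_ : Ring R) (_ : Finite R) (_ : AddCommGroup Q.carrier)
    (_ : Module R Q.carrier),
    (∀ (n : ℕ) (g : (Fin n → Q.carrier) → Q.carrier),
      (∃ t : Term σ n, ∀ x, t.eval Q x = g x) ↔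
      (∃ c : Fin n → R, (∑ i, c i) = 1 ∧ ∀ x, g x = ∑ i, c i • x i)) ∧
    (∃ t : Term σ 3, ∀ x y z : Q.carrier, t.eval Q ![x, y, z] = x - y + z)

/-- `θ` witnesses that `ab` is an edge of the unary type. -/
def UnaryWitness (A : UAlgebra σ) (a b : A.carrier) (θ : Congruence (A.Sg {a, b})) : Prop :=
  θ.IsMaximal ∧ IsSetAlgebra ((A.Sg {a, b}).quot θ)

/-- `θ` witnesses that `ab` is an edge of the semilattice type. -/
def SLWitness (A : UAlgebra σ) (a b : A.carrier) (θ : Congruence (A.Sg {a, b})) : Prop :=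
  θ.IsMaximal ∧ ∃ t : Term σ 2,
    IsSemilatticeOn (fun x y => t.eval ((A.Sg {a, b}).quot θ) ![x, y])
      {A.qa a b θ, A.qb a b θ}

/-- `θ` witnesses that `ab` is an edge of the majority type. -/
def MajWitness (A : UAlgebra σ) (a b : A.carrier) (θ : Congruence (A.Sg {a, b})) : Prop :=
  θ.IsMaximal ∧
  (∃ t : Term σ 3,
    IsMajorityOn (fun x y z => t.eval ((A.Sg {a, b}).quot θ) ![x, y, z])
      {A.qa a b θ, A.qb a b θ}) ∧
  ¬ (∃ t : Term σ 2,
    IsSemilatticeOn (fun x y => t.eval ((A.Sg {a, b}).quot θ) ![x, y])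
      {A.qa a b θ, A.qb a b θ})

/-- `θ` witnesses that `ab` is an edge of the affine type. -/
def AffWitness (A : UAlgebra σ) (a b : A.carrier) (θ : Congruence (A.Sg {a, b})) : Prop :=
  θ.IsMaximal ∧ IsAffineAlgebra ((A.Sg {a, b}).quot θ)

/-- A pair of distinct elements is an edge. -/
def IsEdge (A : UAlgebra σ) (a b : A.carrier) : Prop :=
  a ≠ b ∧ ∃ θ : Congruence (A.Sg {a, b}), ¬ θ.IsFull ∧
    (IsSetAlgebra ((A.Sg {a, b}).quot θ) ∨
     IsAffineAlgebra ((A.Sg {a, b}).quot θ) ∨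
     (∃ t : Term σ 2,
        IsSemilatticeOn (fun x y => t.eval ((A.Sg {a, b}).quot θ) ![x, y])
          {A.qa a b θ, A.qb a b θ}) ∨
     (∃ t : Term σ 3,
        IsMajorityOn (fun x y z => t.eval ((A.Sg {a, b}).quot θ) ![x, y, z])
          {A.qa a b θ, A.qb a b θ}))

def IsUnaryEdge (A : UAlgebra σ) (a b : A.carrier) : Prop :=
  a ≠ b ∧ ∃ θ : Congruence (A.Sg {a, b}), UnaryWitness A a b θ

def IsSLEdge (A : UAlgebra σ) (a b : A.carrier) : Prop :=
  a ≠ b ∧ ∃ θ : Congruence (A.Sg {a, b}), SLWitness A a b θ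

def IsMajEdge (A : UAlgebra σ) (a b : A.carrier) : Prop :=
  a ≠ b ∧ ∃ θ : Congruence (A.Sg {a, b}), MajWitness A a b θ

def IsAffEdge (A : UAlgebra σ) (a b : A.carrier) : Prop :=
  a ≠ b ∧ ∃ θ : Congruence (A.Sg {a, b}), AffWitness A a b θ

end UAlgebra

/-- The four types of edges. -/
inductive EdgeType where
  | unary | semilattice | majority | affine
deriving DecidableEq

namespace UAlgebra

variable {σ : Signature}

def HasEdgeOfType (A : UAlgebra σ) (τ : EdgeType) (a b : A.carrier) : Prop :=
  match τ with
  | .unary => A.IsUnaryEdge a b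
  | .semilattice => A.IsSLEdge a b
  | .majority => A.IsMajEdge a b
  | .affine => A.IsAffEdge a b

/-- `T`-restricted algebra: every edge has a type from `T`. -/
def Restricted (A : UAlgebra σ) (T : Set EdgeType) : Prop :=
  ∀ a b : A.carrier, A.IsEdge a b → ∃ τ ∈ T, A.HasEdgeOfType τ a b

/-- `A` omits type 1: no subalgebra of `A` has an edge of the unary type. -/
def OmitsType1 (A : UAlgebra σ) : Prop :=
  ∀ (S : Set A.carrier) (hS : A.IsClosed S) (a b : (A.subalg S hS).carrier),
    ¬ (A.subalg S hS).IsUnaryEdge a b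

/-- The union of the two `θ`-blocks of a thick edge, as a subset of `A`. -/
def edgeBlockUnion (A : UAlgebra σ) (a b : A.carrier) (θ : Congruence (A.Sg {a, b})) :
    Set A.carrier :=
  {x | ∃ hx : x ∈ A.ClosureSet {a, b},
    θ.rel ⟨x, hx⟩ (A.sgA a b) ∨ θ.rel ⟨x, hx⟩ (A.sgB a b)}

/-- Smooth algebra: for every semilattice- or majority-type edge with a witnessing
maximal congruence, the union of the two blocks is a subuniverse. -/
def IsSmooth (A : UAlgebra σ) : Prop :=
  ∀ (a b : A.carrier) (θ : Congruence (A.Sg {a, b})),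
    (SLWitness A a b θ ∨ MajWitness A a b θ) → A.IsClosed (A.edgeBlockUnion a b θ)

def SemilatticeFree (A : UAlgebra σ) : Prop := ∀ a b : A.carrier, ¬ A.IsSLEdge a b
def MajorityFree (A : UAlgebra σ) : Prop := ∀ a b : A.carrier, ¬ A.IsMajEdge a b
def AffineFree (A : UAlgebra σ) : Prop := ∀ a b : A.carrier, ¬ A.IsAffEdge a b

/-- Thin semilattice edge. -/
def IsThinSLEdge (A : UAlgebra σ) (a b : A.carrier) : Prop :=
  ∃ t : Term σ 2, t.eval A ![a, a] = a ∧ t.eval A ![a, b] = b ∧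
    t.eval A ![b, a] = b ∧ t.eval A ![b, b] = b

/-- Undirected thin majority edge: some term operation is majority on `{a, b}`. -/
def IsUndirThinMajEdge (A : UAlgebra σ) (a b : A.carrier) : Prop :=
  ∃ t : Term σ 3, IsMajorityOn (fun x y z => t.eval A ![x, y, z]) {a, b}

/-- Mal'tsev edge: some term operation is Mal'tsev on `{a, b}`. -/
def IsMaltsevEdge (A : UAlgebra σ) (a b : A.carrier) : Prop :=
  ∃ t : Term σ 3, IsMaltsevOn (fun x y z => t.eval A ![x, y, z]) {a, b}

/-- The class of all quotients of subalgebras of `A`. -/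
def QuotSub (A : UAlgebra σ) : Set (UAlgebra σ) :=
  {B | ∃ (S : Set A.carrier) (hS : A.IsClosed S)
        (θ : Congruence (A.subalg S hS)), B = (A.subalg S hS).quot θ}

end UAlgebra

/-- The class of all quotients of subalgebras of the algebras of a class. -/
def QuotSubClass {σ : Signature} (K : Set (UAlgebra σ)) : Set (UAlgebra σ) :=
  {B | ∃ A ∈ K, B ∈ UAlgebra.QuotSub A}

/-- A ternary term satisfies the majority condition relative to a class `𝒦`. -/
def MajorityCondition {σ : Signature} (𝒦 : Set (UAlgebra σ)) (t : Term σ 3) : Prop :=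
  (∀ B ∈ 𝒦, ∀ x y : B.carrier,
    t.eval B ![x, t.eval B ![x, y, y], t.eval B ![x, y, y]] = t.eval B ![x, y, y]) ∧
  (∀ B ∈ 𝒦, ∀ (a b : B.carrier) (θ : UAlgebra.Congruence (B.Sg {a, b})),
    a ≠ b → UAlgebra.MajWitness B a b θ →
    IsMajorityOn (fun x y z => t.eval ((B.Sg {a, b}).quot θ) ![x, y, z])
      {B.qa a b θ, B.qb a b θ})

/-- A ternary term satisfies the minority condition relative to a class `𝒦`. -/
def MinorityCondition {σ : Signature} (𝒦 : Set (UAlgebra σ)) (t : Term σ 3) : Prop :=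
  (∀ B ∈ 𝒦, ∀ x y : B.carrier,
    t.eval B ![t.eval B ![x, y, y], y, y] = t.eval B ![x, y, y]) ∧
  (∀ B ∈ 𝒦, ∀ (a b : B.carrier) (θ : UAlgebra.Congruence (B.Sg {a, b})),
    a ≠ b → UAlgebra.AffWitness B a b θ →
    IsMaltsevOn (fun x y z => t.eval ((B.Sg {a, b}).quot θ) ![x, y, z])
      {B.qa a b θ, B.qb a b θ})

/-- Thin majority edge relative to a class `𝒦`. -/
def IsThinMajEdge {σ : Signature} (𝒦 : Set (UAlgebra σ)) (A : UAlgebra σ)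
    (a b : A.carrier) : Prop :=
  ∀ t : Term σ 3, MajorityCondition 𝒦 t →
    b ∈ A.ClosureSet {a, t.eval A ![a, b, b]} ∧
    b ∈ A.ClosureSet {a, t.eval A ![b, a, b]} ∧
    b ∈ A.ClosureSet {a, t.eval A ![b, b, a]}

/-- Thin affine edge relative to a class `𝒦` (with respect to some fixed term
operation satisfying the minority condition). -/
def IsThinAffEdge {σ : Signature} (𝒦 : Set (UAlgebra σ)) (A : UAlgebra σ)
    (a b : A.carrier) : Prop :=
  (∃ t : Term σ 3, MinorityCondition 𝒦 t ∧ t.eval A ![b, a, a] = b) ∧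
  ∀ t : Term σ 3, MinorityCondition 𝒦 t → b ∈ A.ClosureSet {a, t.eval A ![a, a, b]}

namespace UAlgebra

variable {σ : Signature}

/-- Reachability in the digraph `Gs(A)` of thin semilattice edges. -/
def sReach (A : UAlgebra σ) : A.carrier → A.carrier → Prop :=
  Relation.ReflTransGen (fun x y => A.IsThinSLEdge x y)

/-- A maximal element of `Gs(A)`: an element of a maximal strongly connected
component. -/
def IsMaxElem (A : UAlgebra σ) (a : A.carrier) : Prop :=
  ∀ b, A.sReach a b → A.sReach b a

/-- A maximal component of `Gs(A)`: the strongly connected component of a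
maximal element. -/
def IsMaxComponent (A : UAlgebra σ) (C : Set A.carrier) : Prop :=
  ∃ a, A.IsMaxElem a ∧ C = {b | A.sReach a b ∧ A.sReach b a}

end UAlgebra

/-- An arc of the digraph `Gas(A)`: a thin semilattice or thin affine edge. -/
def asStep {σ : Signature} (𝒦 : Set (UAlgebra σ)) (A : UAlgebra σ)
    (x y : A.carrier) : Prop :=
  A.IsThinSLEdge x y ∨ IsThinAffEdge 𝒦 A x y

/-- Reachability in `Gas(A)`. -/
def asReach {σ : Signature} (𝒦 : Set (UAlgebra σ)) (A : UAlgebra σ) :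
    A.carrier → A.carrier → Prop :=
  Relation.ReflTransGen (asStep 𝒦 A)

/-- An as-maximal element: an element of an as-component. -/
def IsAsMaxElem {σ : Signature} (𝒦 : Set (UAlgebra σ)) (A : UAlgebra σ)
    (a : A.carrier) : Prop :=
  ∀ b, asReach 𝒦 A a b → asReach 𝒦 A b a

/-- An as-component of `A`: a maximal strongly connected component of `Gas(A)`. -/
def IsAsComponent {σ : Signature} (𝒦 : Set (UAlgebra σ)) (A : UAlgebra σ)
    (C : Set A.carrier) : Prop :=
  ∃ a, IsAsMaxElem 𝒦 A a ∧ C = {b | asReach 𝒦 A a b ∧ asReach 𝒦 A b a}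

namespace UAlgebra

variable {σ : Signature}

/-- Binary direct product. -/
def prod (A B : UAlgebra σ) : UAlgebra σ where
  carrier := A.carrier × B.carrier
  interp f x := (A.interp f fun j => (x j).1, B.interp f fun j => (x j).2)

/-- Direct product of a family. -/
def pi {ι : Type} (A : ι → UAlgebra σ) : UAlgebra σ where
  carrier := ∀ i, (A i).carrier
  interp f x := fun i => (A i).interp f fun j => x j i

/-- Homomorphism of similar algebras. -/
def IsHom (A B : UAlgebra σ) (φ : A.carrier → B.carrier) : Prop :=
  ∀ (f : σ.ops) (x : Fin (σ.arity f) → A.carrier),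
    φ (A.interp f x) = B.interp f fun j => φ (x j)

/-- Simple algebra: only the equality and full congruences. -/
def IsSimple (A : UAlgebra σ) : Prop :=
  ∀ θ : Congruence A, (∀ x y, θ.rel x y ↔ x = y) ∨ θ.IsFull

/-- Maximal generated algebra: generated by one of its maximal components. -/
def MaximalGenerated (A : UAlgebra σ) : Prop :=
  ∃ C : Set A.carrier, A.IsMaxComponent C ∧ A.ClosureSet C = Set.univ

/-- The number of subalgebras (nonempty closed subsets) of an algebra. -/
noncomputable def numSubalgebras (A : UAlgebra σ) : ℕ :=
  Nat.card {S : Set A.carrier // S.Nonempty ∧ A.IsClosed S}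

end UAlgebra

/-- A (k+3)-ary term is an edge term for a class `𝒦`. -/
def IsEdgeTermFor {σ : Signature} (𝒦 : Set (UAlgebra σ)) {k : ℕ}
    (t : Term σ (k + 3)) : Prop :=
  ∀ A ∈ 𝒦, ∀ x y : A.carrier,
    t.eval A (fun i => if i.val ≤ 1 then y else x) = x ∧
    t.eval A (fun i => if i.val = 0 ∨ i.val = 2 then y else x) = x ∧
    ∀ j : Fin (k + 3), 3 ≤ j.val →
      t.eval A (Function.update (fun _ => x) j y) = x

/-- A finite class has few subproducts. -/
def FewSubproducts {σ : Signature} (K : Set (UAlgebra σ)) : Prop :=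
  ∃ p : Polynomial ℕ, ∀ (n : ℕ) (A : Fin n → UAlgebra σ), (∀ i, A i ∈ K) →
    UAlgebra.numSubalgebras (UAlgebra.pi A) ≤ 2 ^ (p.eval n)

/-- `g_K` is bounded by a polynomial: every subalgebra of an `n`-fold product
of members of `K` has a generating set of polynomial size. -/
def PolyGenerated {σ : Signature} (K : Set (UAlgebra σ)) : Prop :=
  ∃ p : Polynomial ℕ, ∀ (n : ℕ) (A : Fin n → UAlgebra σ), (∀ i, A i ∈ K) →
    ∀ S : Set (UAlgebra.pi A).carrier, S.Nonempty → (UAlgebra.pi A).IsClosed S →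
      ∃ G : Set (UAlgebra.pi A).carrier, G ⊆ S ∧ G.Finite ∧
        G.ncard ≤ p.eval n ∧ (UAlgebra.pi A).ClosureSet G = S

/-- Terms over the signature `σ` with variables from an arbitrary type. -/
inductive Tm (σ : Signature) (X : Type) where
  | var : X → Tm σ X
  | app : (f : σ.ops) → (Fin (σ.arity f) → Tm σ X) → Tm σ X

namespace Tm

variable {σ : Signature} {X Y : Type}

/-- Evaluation of a term under an assignment of its variables. -/
def eval (A : UAlgebra σ) : Tm σ X → (X → A.carrier) → A.carrier
  | var v, g => g v
  | app f ts, g => A.interp f fun j => (ts j).eval A g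

/-- Renaming of variables. -/
def map (h : X → Y) : Tm σ X → Tm σ Y
  | var v => var (h v)
  | app f ts => app f fun j => (ts j).map h

/-- Renaming into a finite list of variables. -/
def toTerm {n : ℕ} (h : X → Fin n) : Tm σ X → Term σ n
  | var v => Term.var (h v)
  | app f ts => Term.app f fun j => (ts j).toTerm h

theorem eval_map (A : UAlgebra σ) (h : X → Y) (t : Tm σ X) (g : Y → A.carrier) :
    (t.map h).eval A g = t.eval A fun v => g (h v) := by
  induction t with
  | var v => rfl
  | app f ts ih => simp only [map, eval, ih]

theorem eval_toTerm (A : UAlgebra σ) {n : ℕ} (h : X → Fin n) (t : Tm σ X)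
    (g : Fin n → A.carrier) :
    (t.toTerm h).eval A g = t.eval A fun v => g (h v) := by
  induction t with
  | var v => rfl
  | app f ts ih => simp only [toTerm, eval, Term.eval, ih]

theorem eval_pi {ι : Type} (A : ι → UAlgebra σ) (t : Tm σ X)
    (g : X → (UAlgebra.pi A).carrier) (i : ι) :
    t.eval (UAlgebra.pi A) g i = t.eval (A i) fun v => g v i := by
  induction t with
  | var v => rfl
  | app f ts ih => simp only [eval, UAlgebra.pi, ← ih]

theorem eval_mem {A : UAlgebra σ} {R : Set A.carrier} (hR : A.IsClosed R) (t : Tm σ X)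
    {g : X → A.carrier} (hg : ∀ v, g v ∈ R) : t.eval A g ∈ R := by
  induction t with
  | var v => exact hg v
  | app f ts ih => exact hR f _ ih

theorem eval_const {A : UAlgebra σ} (hA : A.Idempotent) (t : Tm σ X) (a : A.carrier) :
    t.eval A (fun _ => a) = a := by
  induction t with
  | var v => rfl
  | app f ts ih => simp only [eval, ih, hA f a]

theorem exists_eval_of_closure {A : UAlgebra σ} {S : Set A.carrier} {a : A.carrier}
    (h : A.Closure S a) : ∃ t : Tm σ S, t.eval A (fun v => v.1) = a := by
  induction h with
  | base h => exact ⟨var ⟨_, h⟩, rfl⟩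
  | app f x _ ih =>
    choose ts hts using ih
    exact ⟨app f ts, by simp only [eval, hts]⟩

/-- A term involves only finitely many of the variables indexed by `ℕ`. -/
theorem exists_bound (c : X → ℕ) (t : Tm σ X) :
    ∃ k, ∀ (A : UAlgebra σ) (g g' : X → A.carrier),
      (∀ v, c v < k → g v = g' v) → t.eval A g = t.eval A g' := by
  induction t with
  | var v => exact ⟨c v + 1, fun A g g' h => h v (Nat.lt_succ_self _)⟩
  | app f ts ih =>
    choose k hk using ih
    refine ⟨Finset.univ.sup k, fun A g g' h => ?_⟩
    simp only [eval]
    congr 1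
    funext j
    exact hk j A g g' fun v hv => h v (hv.trans_le (Finset.le_sup (Finset.mem_univ j)))

end Tm

namespace Term

variable {σ : Signature} {n : ℕ}

theorem eval_pi {ι : Type} (A : ι → UAlgebra σ) (t : Term σ n)
    (g : Fin n → (UAlgebra.pi A).carrier) (i : ι) :
    t.eval (UAlgebra.pi A) g i = t.eval (A i) fun v => g v i := by
  induction t with
  | var v => rfl
  | app f ts ih => simp only [eval, UAlgebra.pi, ← ih]

theorem eval_mem {A : UAlgebra σ} {R : Set A.carrier} (hR : A.IsClosed R) (t : Term σ n)
    {g : Fin n → A.carrier} (hg : ∀ v, g v ∈ R) : t.eval A g ∈ R := by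
  induction t with
  | var v => exact hg v
  | app f ts ih => exact hR f _ ih

end Term

namespace UAlgebra

variable {σ : Signature}

theorem closureSet_subset {A : UAlgebra σ} {S R : Set A.carrier} (hR : A.IsClosed R)
    (h : S ⊆ R) : A.ClosureSet S ⊆ R := by
  intro a ha
  induction ha with
  | base h' => exact h h'
  | app f x _ ih => exact hR f x ih

theorem subset_closureSet (A : UAlgebra σ) (S : Set A.carrier) : S ⊆ A.ClosureSet S :=
  fun _ h => Closure.base h

theorem idempotent_pi {ι : Type} {A : ι → UAlgebra σ} (h : ∀ i, (A i).Idempotent) :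
    (pi A).Idempotent := fun f a => funext fun i => h i f (a i)

/-- In an idempotent power, a closed set containing a box contains the box of the generated
subalgebras. -/
theorem mem_of_forall_closure {P : UAlgebra σ} (hP : P.Idempotent) {ι : Type} [DecidableEq ι]
    {R : Set (pi fun _ : ι => P).carrier} (hR : (pi fun _ : ι => P).IsClosed R)
    (S : ι → Set P.carrier) (J : Finset ι)
    (h : ∀ a : ι → P.carrier, (∀ j, a j ∈ S j) → a ∈ R) (a : ι → P.carrier)
    (haJ : ∀ j ∈ J, a j ∈ P.ClosureSet (S j)) (ha : ∀ j ∉ J, a j ∈ S j) : a ∈ R := by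
  induction J using Finset.induction_on generalizing a with
  | empty => exact h a fun j => ha j (Finset.notMem_empty j)
  | insert i J hi ih =>
    have key : ∀ z, P.Closure (S i) z → Function.update a i z ∈ R := by
      intro z hz
      induction hz with
      | @base z hz =>
        refine ih _ (fun j hj => ?_) fun j hj => ?_
        · have hji : j ≠ i := fun e => hi (e ▸ hj)
          rw [Function.update_of_ne hji]
          exact haJ j (Finset.mem_insert_of_mem hj)
        · by_cases hji : j = i
          · subst hji
            simpa using hz
          · rw [Function.update_of_ne hji]
            exact ha j (by simp [hji, hj])
      | app f x _ ihx =>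
        have e : Function.update a i (P.interp f x) =
            (pi fun _ : ι => P).interp f fun j => Function.update a i (x j) := by
          funext j
          by_cases hji : j = i
          · subst hji
            simp [pi]
          · simp [pi, hji, hP f]
        rw [e]
        exact hR f _ ihx
    have := key (a i) (haJ i (Finset.mem_insert_self i J))
    rwa [Function.update_eq_self] at this

end UAlgebra

/-- The nonempty finite sets of coordinates that are contained in `{0, …, m - 1}` or are
singletons. -/
def cubeTailSets (m : ℕ) : Set (Finset ℕ) :=
  {V | V.Nonempty ∧ (V ⊆ Finset.range m ∨ ∃ i, V = {i})}

/-- The sequence that agrees with `v` on `V` and is constantly `x` elsewhere. -/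
def spike {α : Type} (x : α) (v : ℕ → α) (V : Finset ℕ) : ℕ → α :=
  fun j => if j ∈ V then v j else x

/-- A term, with variables indexed by the sets in `cubeTailSets m`, returning `x` whenever for
some `j` it is applied to `y` at the sets containing `j` and to `x` at the others. For `m = 2`
this amounts to an edge term, and ordinary cube terms give such terms for large `m`. -/
def IsCubeTailTerm {σ : Signature} (A : UAlgebra σ) {m : ℕ} (s : Tm σ (cubeTailSets m)) : Prop :=
  ∀ (x y : A.carrier) (j : ℕ), s.eval A (fun V => if j ∈ V.1 then y else x) = x

theorem singleton_mem_cubeTailSets (m i : ℕ) : {i} ∈ cubeTailSets m :=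
  ⟨Finset.singleton_nonempty i, Or.inr ⟨i, rfl⟩⟩

namespace UAlgebra

variable {σ : Signature}

/-- A term for `cubeTailSets (m + 1)` forces the constant sequence into every algebra generated
by spikes along `cubeTailSets m`. -/
theorem const_mem_closure_spike {P : UAlgebra σ} [Finite P.carrier] (hP : P.Idempotent)
    {m : ℕ} (hm : 2 ≤ m) {s : Tm σ (cubeTailSets (m + 1))} (hs : IsCubeTailTerm P s)
    (x : P.carrier) (v : ℕ → P.carrier) :
    (fun _ => x) ∈ (pi fun _ : ℕ => P).ClosureSet (spike x v '' cubeTailSets m) := by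
  induction hN : ∑ i ∈ Finset.range m, (P.ClosureSet {x, v i}).ncard using Nat.strong_induction_on
    generalizing v with
  | _ N ih =>
  subst hN
  set G := (pi fun _ : ℕ => P).ClosureSet (spike x v '' cubeTailSets m) with hG
  have hGc : (pi fun _ : ℕ => P).IsClosed G := closureSet_isClosed _ _
  have hsp : ∀ V ∈ cubeTailSets m, spike x v V ∈ G := fun V hV =>
    subset_closureSet _ _ ⟨V, hV, rfl⟩
  have hmk : ∀ (g : cubeTailSets (m + 1) → Finset ℕ) (a : ℕ → P.carrier),
      (∀ V, g V ∈ cubeTailSets m) →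
      (∀ j, s.eval P (fun V => spike x v (g V) j) = a j) → a ∈ G := by
    intro g a hg ha
    have e : (s.eval (pi fun _ : ℕ => P) fun V => spike x v (g V)) = a :=
      funext fun j => (Tm.eval_pi _ s _ j).trans (ha j)
    rw [← e]
    exact Tm.eval_mem hGc s fun V => hsp _ (hg V)
  let d : P.carrier → P.carrier → P.carrier := fun a b =>
    s.eval P fun V => if V.1 = {m} then a else b
  have hd : ∀ a b, (s.eval P fun V => if V.1 = {m} then a else b) = d a b := fun _ _ => rfl
  have hconst : ∀ a : P.carrier, s.eval P (fun _ => a) = a := Tm.eval_const hP s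
  have hd_mem : ∀ a b, d a b ∈ P.ClosureSet {a, b} := fun a b =>
    Tm.eval_mem (closureSet_isClosed _ _) s fun V => by
      apply subset_closureSet
      split_ifs <;> simp
  by_cases hall : ∀ i < m, v i ∈ P.ClosureSet {x, d x (v i)}
  · -- all the binary terms are invertible, so the spikes for `m + 1` can be reached
    let c := d (v m) x
    have hbox : ∀ a : ℕ → P.carrier, (∀ j < m, a j = x ∨ a j = d x (v j)) → a m = c →
        (∀ j, m < j → a j = x) → a ∈ G := by
      classical
      intro a ha1 ha2 ha3
      set U := (Finset.range m).filter fun j => a j ≠ x with hU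
      by_cases hUe : U = ∅
      · have hax : ∀ j < m, a j = x := by
          intro j hj
          by_contra hne
          have : j ∈ U := by simp [hU, hj, hne]
          simp [hUe] at this
        refine hmk (fun V => if V.1 = {m} then {m} else V.1.erase m) a (fun V => ?_) fun j => ?_
        · split_ifs with hV
          · exact singleton_mem_cubeTailSets _ _
          · obtain ⟨V, hVn, hV' | ⟨i, rfl⟩⟩ := V
            · refine ⟨?_, Or.inl fun j hj => ?_⟩
              · rw [Finset.nonempty_iff_ne_empty, Ne, Finset.erase_eq_empty_iff]
                exact fun h => h.elim hVn.ne_empty hV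
              · have h1 := Finset.mem_erase.1 hj
                have h2 := Finset.mem_range.1 (hV' h1.2)
                exact Finset.mem_range.2 (by omega)
            · have : i ≠ m := fun e => hV (congrArg (fun i : ℕ => ({i} : Finset ℕ)) e)
              rw [Finset.erase_eq_of_notMem (by simpa using this.symm)]
              exact singleton_mem_cubeTailSets _ _
        · by_cases hj : j = m
          · subst hj
            rw [ha2, show c = d (v j) x from rfl, ← hd]
            congr 1
            funext V
            by_cases hV : V.1 = {j} <;> simp [spike, hV]
          · have : a j = x := by
              rcases lt_or_gt_of_ne hj with h | h
              · exact hax j h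
              · exact ha3 j h
            rw [this]
            conv_rhs => rw [← hs x (v j) j]
            congr 1
            funext V
            by_cases hV : V.1 = {m} <;> simp [spike, hV, hj]
      · refine hmk (fun V => if V.1 = {m} then {m} else U) a (fun V => ?_) fun j => ?_
        · split_ifs with hV
          · exact singleton_mem_cubeTailSets _ _
          · exact ⟨Finset.nonempty_iff_ne_empty.2 hUe, Or.inl (Finset.filter_subset _ _)⟩
        · by_cases hj : j = m
          · subst hj
            rw [ha2, show c = d (v j) x from rfl, ← hd]
            congr 1
            funext V
            by_cases hV : V.1 = {j} <;> simp [spike, hV, hU]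
          · by_cases hjU : j ∈ U
            · have h1 := Finset.mem_filter.1 hjU
              have h2 := (ha1 j (Finset.mem_range.1 h1.1)).resolve_left h1.2
              rw [h2, ← hd]
              congr 1
              funext V
              by_cases hV : V.1 = {m} <;> simp [spike, hV, hj, hjU]
            · have : a j = x := by
                rcases lt_or_gt_of_ne hj with h | h
                · by_contra hne
                  exact hjU (by simp [hU, h, hne])
                · exact ha3 j h
              rw [this]
              conv_rhs => rw [← hconst x]
              congr 1
              funext V
              by_cases hV : V.1 = {m} <;> simp [spike, hV, hj, hjU]
    let v' : ℕ → P.carrier := Function.update v m c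
    have hnew : ∀ W ∈ cubeTailSets (m + 1), spike x v' W ∈ G := by
      rintro W ⟨hWn, hW⟩
      by_cases hmW : m ∈ W
      · have hWr : ∀ j ∈ W, j ≤ m := by
          rcases hW with hW | ⟨i, rfl⟩
          · exact fun j hj => Nat.lt_succ_iff.1 (Finset.mem_range.1 (hW hj))
          · intro j hj
            rw [Finset.mem_singleton] at hj hmW
            omega
        refine mem_of_forall_closure hP hGc
          (fun j => if j < m then {x, d x (v j)} else {spike x v' W j}) (Finset.range m)
          (fun a ha => ?_) (spike x v' W) (fun j hj => ?_) fun j hj => ?_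
        · refine hbox a (fun j hj => ?_) ?_ fun j hj => ?_
          · simpa [hj] using ha j
          · have := ha m
            simpa [spike, hmW, v'] using this
          · have h1 := ha j
            have h2 : j ∉ W := fun h => absurd (hWr j h) (by omega)
            simpa [spike, h2, not_lt.2 hj.le] using h1
        · rw [Finset.mem_range] at hj
          simp only [hj, if_true]
          by_cases hjW : j ∈ W
          · have : spike x v' W j = v j := by simp [spike, hjW, v', hj.ne]
            rw [this]
            exact hall j hj
          · have : spike x v' W j = x := by simp [spike, hjW]
            rw [this]
            exact subset_closureSet _ _ (by simp)
        · rw [Finset.mem_range] at hj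
          simp [hj]
      · have e : spike x v' W = spike x v W := by
          funext j
          by_cases hjW : j ∈ W
          · have : j ≠ m := fun e => hmW (e ▸ hjW)
            simp [spike, hjW, v', this]
          · simp [spike, hjW]
        rw [e]
        refine hsp W ⟨hWn, hW.imp_left fun h j hj => ?_⟩
        have h1 := Finset.mem_range.1 (h hj)
        have : j ≠ m := fun e => hmW (e ▸ hj)
        exact Finset.mem_range.2 (by omega)
    have e : (s.eval (pi fun _ : ℕ => P) fun V => spike x v' V.1) = fun _ => x :=
      funext fun j => (Tm.eval_pi _ s _ j).trans (hs x (v' j) j)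
    rw [← e]
    exact Tm.eval_mem hGc s fun V => hnew _ V.2
  · push Not at hall
    obtain ⟨i, him, hi⟩ := hall
    let v' : ℕ → P.carrier := Function.update v i (d x (v i))
    obtain ⟨i', hi'm, hii'⟩ : ∃ i' < m, i' ≠ i := by
      by_cases h : i = 0
      · exact ⟨1, by omega, by omega⟩
      · exact ⟨0, by omega, by omega⟩
    have hsub : P.ClosureSet {x, d x (v i)} ⊆ P.ClosureSet {x, v i} := by
      apply closureSet_subset (closureSet_isClosed _ _)
      rintro z (rfl | rfl)
      · exact subset_closureSet _ _ (by simp)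
      · exact hd_mem _ _
    have hlt : ∑ j ∈ Finset.range m, (P.ClosureSet {x, v' j}).ncard <
        ∑ j ∈ Finset.range m, (P.ClosureSet {x, v j}).ncard := by
      refine Finset.sum_lt_sum (fun j _ => ?_) ⟨i, Finset.mem_range.2 him, ?_⟩
      · by_cases hji : j = i
        · subst hji
          simpa [v'] using Set.ncard_le_ncard hsub (Set.toFinite _)
        · simp [v', hji]
      · refine Set.ncard_lt_ncard ?_ (Set.toFinite _)
        simp only [v', Function.update_self]
        exact ⟨hsub, fun h => hi (h (subset_closureSet _ _ (by simp)))⟩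
    refine closureSet_subset hGc ?_ (ih _ hlt v' rfl)
    rintro _ ⟨W, ⟨hWn, hW⟩, rfl⟩
    by_cases hiW : i ∈ W
    · have hWm : W ⊆ Finset.range m := by
        rcases hW with hW | ⟨j, rfl⟩
        · exact hW
        · rw [Finset.mem_singleton] at hiW
          simpa [← hiW] using him
      by_cases hWi : W = {i}
      · subst hWi
        refine hmk (fun V => if V.1 = {m} then {i'} else if m ∈ V.1 then {i, i'} else {i}) _
          (fun V => ?_) fun j => ?_
        · split_ifs
          · exact singleton_mem_cubeTailSets _ _
          · refine ⟨by simp, Or.inl ?_⟩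
            intro j hj
            simp only [Finset.mem_insert, Finset.mem_singleton] at hj
            rw [Finset.mem_range]
            omega
          · exact singleton_mem_cubeTailSets _ _
        · by_cases hji : j = i
          · subst hji
            have : spike x v' {j} j = d x (v j) := by simp [spike, v']
            rw [this, ← hd]
            congr 1
            funext V
            by_cases hV : V.1 = {m}
            · simp [spike, hV, hii'.symm]
            · by_cases hmV : m ∈ V.1 <;> simp [spike, hV, hmV]
          · have : spike x v' {i} j = x := by simp [spike, hji]
            rw [this]
            by_cases hji' : j = i'
            · subst hji'
              conv_rhs => rw [← hs x (v j) m]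
              congr 1
              funext V
              by_cases hV : V.1 = {m}
              · simp [spike, hV]
              · by_cases hmV : m ∈ V.1 <;> simp [spike, hV, hmV, hii']
            · conv_rhs => rw [← hconst x]
              congr 1
              funext V
              by_cases hV : V.1 = {m}
              · simp [spike, hV, hji']
              · by_cases hmV : m ∈ V.1 <;> simp [spike, hV, hmV, hji, hji']
      · refine hmk (fun V => if V.1 = {m} then W.erase i else W) _ (fun V => ?_) fun j => ?_
        · split_ifs
          · refine ⟨?_, Or.inl ((Finset.erase_subset _ _).trans hWm)⟩
            rw [Finset.nonempty_iff_ne_empty, Ne, Finset.erase_eq_empty_iff]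
            exact fun h => h.elim hWn.ne_empty hWi
          · exact ⟨hWn, Or.inl hWm⟩
        · by_cases hji : j = i
          · subst hji
            have : spike x v' W j = d x (v j) := by simp [spike, v', hiW]
            rw [this, ← hd]
            congr 1
            funext V
            by_cases hV : V.1 = {m} <;> simp [spike, hV, hiW]
          · have : spike x v' W j = spike x v W j := by simp [spike, v', hji]
            rw [this]
            conv_rhs => rw [← hconst (spike x v W j)]
            congr 1
            funext V
            by_cases hV : V.1 = {m} <;> simp [spike, hV, hji]
    · have e : spike x v' W = spike x v W := by
        funext j
        by_cases hjW : j ∈ W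
        · have : j ≠ i := fun e => hiW (e ▸ hjW)
          simp [spike, hjW, v', this]
        · simp [spike, hjW]
      rw [e]
      exact hsp W ⟨hWn, hW⟩

end UAlgebra

/-- A finite class of finite algebras admits a finite list of all its pairs of elements. -/
theorem exists_enum_pairs {σ : Signature} {K : Set (UAlgebra σ)} (hK : K.Finite)
    (hfin : ∀ A ∈ K, Finite A.carrier) :
    ∃ (q : ℕ) (B : Fin q → UAlgebra σ) (x y : (UAlgebra.pi B).carrier),
      (∀ i, B i ∈ K) ∧
      ∀ p : (A : UAlgebra σ) → A.carrier → A.carrier → Prop,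
        (∀ i, p (B i) (x i) (y i)) → ∀ A ∈ K, ∀ a b, p A a b := by
  have : Finite K := hK
  have : ∀ A : K, Finite A.1.carrier := fun A => hfin A.1 A.2
  obtain ⟨q, ⟨e⟩⟩ := Finite.exists_equiv_fin (Σ A : K, A.1.carrier × A.1.carrier)
  refine ⟨q, fun i => (e.symm i).1.1, fun i => (e.symm i).2.1, fun i => (e.symm i).2.2,
    fun i => (e.symm i).1.2, fun p hp A hA a b => ?_⟩
  obtain ⟨i, hi⟩ := e.symm.surjective ⟨⟨A, hA⟩, a, b⟩
  have h := hp i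
  dsimp only at h
  rwa [hi] at h

section CubeTailTerms

variable {σ : Signature} {K : Set (UAlgebra σ)}

theorem exists_isCubeTailTerm_of_succ (hK : K.Finite) (hfin : ∀ A ∈ K, Finite A.carrier)
    (hid : ∀ A ∈ K, A.Idempotent) {m : ℕ} (hm : 2 ≤ m)
    (h : ∃ s : Tm σ (cubeTailSets (m + 1)), ∀ A ∈ K, IsCubeTailTerm A s) :
    ∃ s : Tm σ (cubeTailSets m), ∀ A ∈ K, IsCubeTailTerm A s := by
  obtain ⟨s, hs⟩ := h
  obtain ⟨q, B, x, y, hB, hp⟩ := exists_enum_pairs hK hfin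
  have : ∀ i, Finite (B i).carrier := fun i => hfin _ (hB i)
  have : Finite (UAlgebra.pi B).carrier := inferInstanceAs (Finite (∀ i, (B i).carrier))
  have hPs : IsCubeTailTerm (UAlgebra.pi B) s := by
    intro a b j
    funext i
    rw [Tm.eval_pi]
    conv_rhs => rw [← hs _ (hB i) (a i) (b i) j]
    congr 1
    funext V
    split_ifs <;> rfl
  obtain ⟨t, ht⟩ := Tm.exists_eval_of_closure (UAlgebra.const_mem_closure_spike
    (UAlgebra.idempotent_pi fun i => hid _ (hB i)) hm hPs x fun _ => y)
  have hV : ∀ v : spike (α := (UAlgebra.pi B).carrier) x (fun _ => y) '' cubeTailSets m,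
      ∃ V : cubeTailSets m, spike (α := (UAlgebra.pi B).carrier) x (fun _ => y) V.1 = v.1 :=
    fun v => ⟨⟨v.2.choose, v.2.choose_spec.1⟩, v.2.choose_spec.2⟩
  choose V hV using hV
  refine ⟨t.map V, fun A hA a b => hp (fun A a b => ∀ j : ℕ,
    (t.map V).eval A (fun W => if j ∈ W.1 then b else a) = a) (fun i j => ?_) A hA a b⟩
  have h1 := congrFun (congrFun ht j) i
  rw [Tm.eval_pi, Tm.eval_pi] at h1
  refine (Tm.eval_map _ V t _).trans (Eq.trans ?_ h1)
  congr 1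
  funext v
  rw [← hV v, spike]
  split_ifs <;> rfl

theorem exists_isCubeTailTerm_two (hK : K.Finite) (hfin : ∀ A ∈ K, Finite A.carrier)
    (hid : ∀ A ∈ K, A.Idempotent) {m : ℕ} (hm : 2 ≤ m)
    (h : ∃ s : Tm σ (cubeTailSets m), ∀ A ∈ K, IsCubeTailTerm A s) :
    ∃ s : Tm σ (cubeTailSets 2), ∀ A ∈ K, IsCubeTailTerm A s := by
  induction m, hm using Nat.le_induction with
  | base => exact h
  | succ m hm ih => exact ih (exists_isCubeTailTerm_of_succ hK hfin hid hm h)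

theorem exists_isEdgeTermFor_of_isCubeTailTerm {s : Tm σ (cubeTailSets 2)}
    (hs : ∀ A ∈ K, IsCubeTailTerm A s) : ∃ (k : ℕ) (t : Term σ (k + 3)), IsEdgeTermFor K t := by
  obtain ⟨k, hk⟩ := s.exists_bound fun V => V.1.sup id
  let h : cubeTailSets 2 → Fin (k + 3) := fun V =>
    if V.1 = {0, 1} then 0 else if V.1 = {0} then 1 else if V.1 = {1} then 2 else
      if hV : V.1.sup id < k then ⟨V.1.sup id + 1, by omega⟩ else 0
  have hcases : ∀ V : cubeTailSets 2, V.1.sup id < k →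
      (V.1 = {0, 1} ∧ (h V).1 = 0) ∨ (V.1 = {0} ∧ (h V).1 = 1) ∨
        ∃ i, 1 ≤ i ∧ V.1 = {i} ∧ (h V).1 = i + 1 := by
    rintro ⟨V, hVn, hV⟩ hlt
    by_cases h1 : V = {0, 1}
    · exact Or.inl ⟨h1, by simp [h, h1]⟩
    obtain ⟨i, rfl⟩ : ∃ i, V = {i} := by
      rcases hV with hV | hV
      · have h2 : V ∈ (Finset.range 2).powerset := Finset.mem_powerset.2 hV
        have h3 : (Finset.range 2).powerset = {∅, {0}, {1}, {0, 1}} := by decide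
        rw [h3] at h2
        simp only [Finset.mem_insert, Finset.mem_singleton] at h2
        rcases h2 with rfl | h2 | h2 | h2
        · exact absurd hVn (by simp)
        · exact ⟨_, h2⟩
        · exact ⟨_, h2⟩
        · exact absurd h2 h1
      · exact hV
    right
    rcases Nat.eq_zero_or_pos i with rfl | hi
    · exact Or.inl ⟨rfl, by simp [h, h1]⟩
    · refine Or.inr ⟨i, hi, rfl, ?_⟩
      have h0 : i ≠ 0 := hi.ne'
      simp only [Finset.sup_singleton, id] at hlt
      by_cases h2 : i = 1
      · subst h2
        simp [h, h1]
      · simp [h, h1, h0, h2, hlt]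
  have key : ∀ A ∈ K, ∀ (x y : A.carrier) (j : ℕ) (g : Fin (k + 3) → A.carrier),
      (∀ i, g i = if (j = 0 ∧ i.1 ≤ 1) ∨ (j = 1 ∧ (i.1 = 0 ∨ i.1 = 2)) ∨ (2 ≤ j ∧ i.1 = j + 1)
        then y else x) → (s.toTerm h).eval A g = x := by
    intro A hA x y j g hg
    rw [Tm.eval_toTerm]
    conv_rhs => rw [← hs A hA x y j]
    refine hk A _ _ fun V hV => ?_
    rw [hg]
    congr 1
    rcases hcases V hV with ⟨h1, h2⟩ | ⟨h1, h2⟩ | ⟨i, hi, h1, h2⟩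
    · rw [h1, h2]
      simp only [Finset.mem_insert, Finset.mem_singleton, eq_iff_iff]
      grind
    · rw [h1, h2]
      simp only [Finset.mem_singleton, eq_iff_iff]
      omega
    · rw [h1, h2]
      simp only [Finset.mem_singleton, eq_iff_iff]
      omega
  refine ⟨k, s.toTerm h, fun A hA x y => ⟨key A hA x y 0 _ fun i => by simp,
    key A hA x y 1 _ fun i => by simp, fun j hj => key A hA x y (j.1 - 1) _ fun i => ?_⟩⟩
  rw [Function.update_apply]
  congr 1
  rw [Fin.ext_iff, eq_iff_iff]
  omega

end CubeTailTerms

theorem Polynomial.eval_le_eval_one_mul_pow (p : Polynomial ℕ) (N : ℕ) :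
    p.eval N ≤ p.eval 1 * (N + 1) ^ p.natDegree := by
  rw [Polynomial.eval_eq_sum_range, Polynomial.eval_eq_sum_range, Finset.sum_mul]
  refine Finset.sum_le_sum fun i hi => ?_
  rw [one_pow, mul_one]
  refine Nat.mul_le_mul_left _ ((Nat.pow_le_pow_left (Nat.le_succ N) i).trans ?_)
  exact Nat.pow_le_pow_right (Nat.succ_pos N) (Nat.lt_succ_iff.1 (Finset.mem_range.1 hi))

/-- A polynomial does not dominate a power of larger degree along a linear progression. -/
theorem Polynomial.exists_eval_mul_lt_pow (p : Polynomial ℕ) (c : ℕ) :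
    ∃ n : ℕ, p.eval (c * n) < n ^ (p.natDegree + 2) := by
  set d := p.natDegree
  set a := p.eval 1 * (c + 1) ^ d
  refine ⟨a + 1, (p.eval_le_eval_one_mul_pow _).trans_lt ?_⟩
  calc p.eval 1 * (c * (a + 1) + 1) ^ d
      ≤ p.eval 1 * ((c + 1) * (a + 1)) ^ d := by
        refine Nat.mul_le_mul_left _ (Nat.pow_le_pow_left ?_ d)
        rw [add_one_mul]
        omega
    _ = a * (a + 1) ^ d := by rw [mul_pow, ← mul_assoc]
    _ < (a + 1) ^ 2 * (a + 1) ^ d := by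
        refine Nat.mul_lt_mul_of_pos_right ?_ (by positivity)
        nlinarith
    _ = (a + 1) ^ (d + 2) := by rw [← pow_add, add_comm 2 d]

section FewSubproducts

variable {σ : Signature} {K : Set (UAlgebra σ)}

/-- Without a cube-tail term there are many subalgebras of suitable powers. -/
theorem exists_pow_le_numSubalgebras (hK : K.Finite) (hfin : ∀ A ∈ K, Finite A.carrier)
    (hid : ∀ A ∈ K, A.Idempotent) {k : ℕ} (hk : 0 < k)
    (h : ¬ ∃ s : Tm σ (cubeTailSets k), ∀ A ∈ K, IsCubeTailTerm A s) :
    ∃ c : ℕ, ∀ n : ℕ, ∃ A : Fin (c * n) → UAlgebra σ, (∀ i, A i ∈ K) ∧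
      2 ^ n ^ k ≤ (UAlgebra.pi A).numSubalgebras := by
  obtain ⟨q, B, x, y, hB, hp⟩ := exists_enum_pairs hK hfin
  refine ⟨k * q, fun n => ?_⟩
  let e : Fin (k * q * n) ≃ (Fin k × Fin q) × Fin n :=
    finProdFinEquiv.symm.trans (finProdFinEquiv.symm.prodCongr (Equiv.refl _))
  let A : Fin (k * q * n) → UAlgebra σ := fun i => B (e i).1.2
  refine ⟨A, fun i => hB _, ?_⟩
  have : ∀ i, Finite (A i).carrier := fun i => hfin _ (hB _)
  have : Finite (UAlgebra.pi A).carrier := inferInstanceAs (Finite (∀ i, (A i).carrier))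
  let g : (Fin k → Fin n) → (UAlgebra.pi A).carrier := fun T i =>
    if T (e i).1.1 = (e i).2 then x (e i).1.2 else y (e i).1.2
  let y' : (UAlgebra.pi A).carrier := fun i => y (e i).1.2
  have key : ∀ (S : Set (Fin k → Fin n)) (T : Fin k → Fin n),
      g T ∈ (UAlgebra.pi A).ClosureSet (insert y' (g '' S)) → T ∈ S := by
    intro S T hT
    by_contra hTS
    obtain ⟨t, ht⟩ := Tm.exists_eval_of_closure hT
    have hV : ∀ v : ↑(insert y' (g '' S)), ∃ V : cubeTailSets k, V.1 ⊆ Finset.range k ∧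
        ∀ c, T (e c).1.1 = (e c).2 → v.1 c = if (e c).1.1.1 ∈ V.1 then y _ else x _ := by
      rintro ⟨v, rfl | ⟨T', hT', rfl⟩⟩
      · refine ⟨⟨Finset.range k, ⟨0, Finset.mem_range.2 hk⟩, Or.inl subset_rfl⟩, subset_rfl,
          fun c _ => ?_⟩
        simp [y']
      · have hne : T' ≠ T := fun e => hTS (e ▸ hT')
        obtain ⟨l, hl⟩ := Function.ne_iff.1 hne
        set D := (Finset.univ.filter fun l => T' l ≠ T l).map Fin.valEmbedding
        have hD : ∀ l : Fin k, l.1 ∈ D ↔ T' l ≠ T l := fun l =>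
          (Finset.mem_map' Fin.valEmbedding).trans (by simp)
        have hDk : D ⊆ Finset.range k := fun j hj => by
          obtain ⟨l, -, rfl⟩ := Finset.mem_map.1 hj
          exact Finset.mem_range.2 l.2
        refine ⟨⟨D, ⟨l.1, (hD l).2 hl⟩, Or.inl hDk⟩, hDk, fun c hc => ?_⟩
        simp only [g, hD, ← hc, ite_not, ne_eq]
    choose V hVk hV using hV
    refine h ⟨t.map V, hp (fun A a b => ∀ j : ℕ,
      (t.map V).eval A (fun W => if j ∈ W.1 then b else a) = a) fun i j => ?_⟩
    refine (Tm.eval_map _ V t _).trans ?_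
    by_cases hj : j < k
    · obtain ⟨c, hc⟩ := e.surjective ((⟨j, hj⟩, i), T ⟨j, hj⟩)
      obtain rfl : (e c).1.2 = i := by rw [hc]
      have hcj : (e c).1.1 = ⟨j, hj⟩ := by rw [hc]
      have hcT : T (e c).1.1 = (e c).2 := by rw [hcj, hc]
      have h1 := congrFun ht c
      rw [Tm.eval_pi, show g T c = x (e c).1.2 from if_pos hcT] at h1
      conv_rhs => rw [← h1]
      congr 1
      funext v
      rw [hV v c hcT, hcj]
    · conv_rhs => rw [← Tm.eval_const (hid _ (hB i)) t (x i)]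
      congr 1
      funext v
      exact if_neg fun hjV => hj (Finset.mem_range.1 (hVk v hjV))
  let Φ : Set (Fin k → Fin n) →
      {R : Set (UAlgebra.pi A).carrier // R.Nonempty ∧ (UAlgebra.pi A).IsClosed R} := fun S =>
    ⟨(UAlgebra.pi A).ClosureSet (insert y' (g '' S)),
      ⟨y', UAlgebra.subset_closureSet _ _ (Set.mem_insert _ _)⟩,
      UAlgebra.closureSet_isClosed _ _⟩
  have hle : ∀ S S', Φ S = Φ S' → S ⊆ S' := fun S S' hS T hT => by
    refine key S' T ?_
    have hS' : (UAlgebra.pi A).ClosureSet (insert y' (g '' S)) =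
      (UAlgebra.pi A).ClosureSet (insert y' (g '' S')) := congrArg Subtype.val hS
    rw [← hS']
    exact UAlgebra.subset_closureSet _ _ (Set.mem_insert_of_mem _ ⟨T, hT, rfl⟩)
  have := Nat.card_le_card_of_injective Φ fun S S' hS =>
    (hle S S' hS).antisymm (hle S' S hS.symm)
  simpa [Nat.card_eq_fintype_card, Fintype.card_set, UAlgebra.numSubalgebras] using this

theorem exists_isEdgeTermFor_of_fewSubproducts (hK : K.Finite)
    (hfin : ∀ A ∈ K, Finite A.carrier) (hid : ∀ A ∈ K, A.Idempotent) (h : FewSubproducts K) :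
    ∃ (k : ℕ) (t : Term σ (k + 3)), IsEdgeTermFor K t := by
  obtain ⟨p, hp⟩ := h
  by_contra hno
  have h1 : ¬ ∃ s : Tm σ (cubeTailSets (p.natDegree + 2)), ∀ A ∈ K, IsCubeTailTerm A s := by
    intro h1
    obtain ⟨s, hs⟩ := exists_isCubeTailTerm_two hK hfin hid (Nat.le_add_left _ _) h1
    exact hno (exists_isEdgeTermFor_of_isCubeTailTerm hs)
  obtain ⟨c, hc⟩ := exists_pow_le_numSubalgebras hK hfin hid (Nat.succ_pos _) h1
  obtain ⟨n, hn⟩ := p.exists_eval_mul_lt_pow c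
  obtain ⟨A, hA, hle⟩ := hc n
  exact absurd ((Nat.pow_le_pow_iff_right one_lt_two).1 (hle.trans (hp _ A hA))) (not_le.2 hn)

end FewSubproducts

section EdgeTerms

variable {σ : Signature}

/-- The value of an edge term, with its first two arguments separated. -/
def Term.edgeEval (A : UAlgebra σ) {k : ℕ} (t : Term σ (k + 3)) (p q : A.carrier)
    (u : Fin (k + 1) → A.carrier) : A.carrier :=
  t.eval A (Fin.cons p (Fin.cons q u))

namespace Term

variable {k : ℕ}

theorem edgeEval_pi {ι : Type} (A : ι → UAlgebra σ) (t : Term σ (k + 3))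
    (p q : (UAlgebra.pi A).carrier) (u : Fin (k + 1) → (UAlgebra.pi A).carrier) (i : ι) :
    t.edgeEval (UAlgebra.pi A) p q u i = t.edgeEval (A i) (p i) (q i) fun l => u l i := by
  refine (eval_pi A t _ i).trans (congrArg _ (funext fun v => ?_))
  refine Fin.cases rfl (fun v => ?_) v
  exact Fin.cases rfl (fun v => rfl) v

theorem edgeEval_mem {A : UAlgebra σ} {R : Set A.carrier} (hR : A.IsClosed R)
    (t : Term σ (k + 3)) {p q : A.carrier} {u : Fin (k + 1) → A.carrier} (hp : p ∈ R)
    (hq : q ∈ R) (hu : ∀ l, u l ∈ R) : t.edgeEval A p q u ∈ R := by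
  refine eval_mem hR t fun v => ?_
  refine Fin.cases hp (fun v => ?_) v
  exact Fin.cases hq (fun v => hu v) v

end Term

namespace IsEdgeTermFor

variable {K : Set (UAlgebra σ)} {k : ℕ} {t : Term σ (k + 3)}

theorem edgeEval_same (ht : IsEdgeTermFor K t) {A : UAlgebra σ} (hA : A ∈ K)
    (x y : A.carrier) : t.edgeEval A y y (fun _ => x) = x := by
  conv_rhs => rw [← (ht A hA x y).1]
  refine congrArg (t.eval A) (funext fun v => ?_)
  refine Fin.cases (by simp) (fun v => ?_) v
  exact Fin.cases (by simp) (fun v => by simp) v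

theorem edgeEval_near (ht : IsEdgeTermFor K t) {A : UAlgebra σ} (hA : A ∈ K)
    (x : A.carrier) (u : Fin (k + 1) → A.carrier) (l : Fin (k + 1))
    (hu : ∀ l' ≠ l, u l' = x) : t.edgeEval A (u 0) x u = x := by
  have hv : ∀ v, u v = if v = l then u l else x := fun v => by
    split_ifs with h
    · rw [h]
    · exact hu v h
  by_cases hl : l = 0
  · subst hl
    conv_rhs => rw [← (ht A hA x (u 0)).2.1]
    refine congrArg (t.eval A) (funext fun v => ?_)
    refine Fin.cases (by simp) (fun v => ?_) v
    refine Fin.cases (by simp) (fun v => ?_) v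
    rw [Fin.cons_succ, Fin.cons_succ, hv]
    congr 1
    rw [eq_iff_iff, Fin.ext_iff, Fin.val_succ, Fin.val_succ, Fin.val_zero]
    omega
  · conv_rhs => rw [← (ht A hA x (u l)).2.2 l.succ.succ (by
      have := Fin.pos_iff_ne_zero.2 hl
      simp only [Fin.val_succ]
      omega)]
    refine congrArg (t.eval A) (funext fun v => ?_)
    rw [Function.update_apply]
    refine Fin.cases ?_ (fun v => ?_) v
    · rw [Fin.cons_zero, hu 0 (Ne.symm hl), if_neg (Fin.succ_ne_zero _).symm]
    refine Fin.cases ?_ (fun v => ?_) v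
    · rw [Fin.cons_succ, Fin.cons_zero, if_neg]
      exact fun h => (Fin.succ_ne_zero _).symm (Fin.succ_injective _ h)
    rw [Fin.cons_succ, Fin.cons_succ, hv]
    simp

/-- In the presence of an edge term, a subalgebra of a finite product is determined by its forks
and its projections to few coordinates. -/
theorem subset_of_fork_of_proj (ht : IsEdgeTermFor K t) {n : ℕ} {A : Fin n → UAlgebra σ}
    (hA : ∀ i, A i ∈ K) {R R' : Set (UAlgebra.pi A).carrier} (hR' : (UAlgebra.pi A).IsClosed R')
    (hsub : R' ⊆ R) (hne : R'.Nonempty)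
    (hfork : ∀ i, ∀ r ∈ R, ∀ r' ∈ R, (∀ j < i, r j = r' j) →
      ∃ u ∈ R', ∃ u' ∈ R', (∀ j < i, u j = u' j) ∧ u i = r i ∧ u' i = r' i)
    (hproj : ∀ r ∈ R, ∀ c : Fin (k + 1) → Fin n, ∃ u ∈ R', ∀ l, u (c l) = r (c l)) :
    R ⊆ R' := by
  intro r hr
  suffices h : ∀ i ≤ n, ∃ s ∈ R', ∀ j : Fin n, j.1 < i → s j = r j by
    obtain ⟨s, hs, hsr⟩ := h n le_rfl
    have e : r = s := funext fun j => (hsr j j.2).symm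
    rw [e]
    exact hs
  intro i hi
  induction i with
  | zero =>
    obtain ⟨s, hs⟩ := hne
    exact ⟨s, hs, fun j hj => absurd hj (Nat.not_lt_zero _)⟩
  | succ i ih =>
    obtain ⟨s, hs, hsr⟩ := ih (Nat.le_of_succ_le hi)
    set ii : Fin n := ⟨i, hi⟩
    have hlt : ∀ j : Fin n, j < ii → s j = r j := fun j hj => hsr j hj
    obtain ⟨U, hU, U', hU', hUU, hUr, hUs⟩ :=
      hfork ii r hr s (hsub hs) fun j hj => (hlt j hj).symm
    have claim : ∀ I : Finset (Fin n), (∀ j ∈ I, j < ii) →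
        ∃ u ∈ R', u ii = r ii ∧ ∀ j ∈ I, u j = r j := by
      intro I
      induction I using Finset.strongInduction with
      | H I ihI =>
      intro hI
      by_cases hcard : I.card ≤ k
      · obtain ⟨u, hu, hur⟩ := hproj r hr fun l => (insert ii I).toList.getD l ii
        have hall : ∀ j ∈ insert ii I, u j = r j := by
          intro j hj
          obtain ⟨l, hl, rfl⟩ := List.mem_iff_getElem.1 (Finset.mem_toList.2 hj)
          have hl' : l < k + 1 := by
            have h1 := Finset.card_insert_le ii I
            rw [Finset.length_toList] at hl
            omega
          have := hur ⟨l, hl'⟩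
          rwa [List.getD_eq_getElem _ _ hl] at this
        exact ⟨u, hu, hall _ (Finset.mem_insert_self _ _),
          fun j hj => hall j (Finset.mem_insert_of_mem hj)⟩
      · obtain ⟨J, hJI, hJ⟩ := Finset.exists_subset_card_eq (Nat.succ_le_of_lt (not_le.1 hcard))
        set c := J.orderEmbOfFin hJ
        have hc : ∀ l, c l ∈ I := fun l => hJI (Finset.orderEmbOfFin_mem J hJ l)
        have hu : ∀ l, ∃ u ∈ R', u ii = r ii ∧ ∀ j ∈ I.erase (c l), u j = r j := fun l =>
          ihI _ (Finset.erase_ssubset (hc l)) fun j hj => hI j (Finset.mem_of_mem_erase hj)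
        choose u hu hui huj using hu
        have hnear : ∀ j ∈ I, t.edgeEval (A j) (u 0 j) (r j) (fun l => u l j) = r j := by
          intro j hj
          by_cases hjc : ∃ l, j = c l
          · obtain ⟨l, rfl⟩ := hjc
            exact ht.edgeEval_near (hA _) _ (fun l' => u l' (c l)) l fun l' hl' =>
              huj l' _ (Finset.mem_erase.2 ⟨fun e => hl' (c.injective e).symm, hj⟩)
          · push Not at hjc
            exact ht.edgeEval_near (hA _) _ (fun l' => u l' j) 0 fun l' _ =>
              huj l' _ (Finset.mem_erase.2 ⟨hjc l', hj⟩)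
        set w := t.edgeEval (UAlgebra.pi A) (u 0) s u with hw
        set C := t.edgeEval (UAlgebra.pi A) U U' fun _ => u 0 with hC
        have hwI : ∀ j ∈ I, w j = r j := fun j hj => by
          rw [hw, Term.edgeEval_pi, hlt j (hI j hj), hnear j hj]
        have hCI : ∀ j ∈ I, C j = u 0 j := fun j hj => by
          rw [hC, Term.edgeEval_pi, hUU j (hI j hj), ht.edgeEval_same (hA j)]
        have hwC : w ii = C ii := by
          rw [hw, hC, Term.edgeEval_pi, Term.edgeEval_pi, hUr, hUs]
          simp only [hui]
        refine ⟨t.edgeEval (UAlgebra.pi A) C w u, Term.edgeEval_mem hR' t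
          (Term.edgeEval_mem hR' t hU hU' fun _ => hu 0)
          (Term.edgeEval_mem hR' t (hu 0) hs hu) hu, ?_, fun j hj => ?_⟩
        · rw [Term.edgeEval_pi, hwC]
          simp only [hui]
          exact ht.edgeEval_same (hA ii) _ _
        · rw [Term.edgeEval_pi, hwI j hj, hCI j hj, hnear j hj]
    obtain ⟨u, hu, hui, huj⟩ := claim (Finset.univ.filter fun j => j < ii) (by simp)
    refine ⟨u, hu, fun j hj => ?_⟩
    rcases Nat.lt_succ_iff_lt_or_eq.1 hj with h | h
    · exact huj j (Finset.mem_filter.2 ⟨Finset.mem_univ _, h⟩)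
    · rw [show j = ii from Fin.ext h, hui]

end IsEdgeTermFor

end EdgeTerms

section PolyGenerated

variable {σ : Signature} {K : Set (UAlgebra σ)}

theorem exists_card_le (hK : K.Finite) : ∃ m : ℕ, ∀ A ∈ K, Nat.card A.carrier ≤ m := by
  obtain ⟨m, hm⟩ := (hK.image fun A => Nat.card A.carrier).bddAbove
  exact ⟨m, fun A hA => hm ⟨A, hA, rfl⟩⟩

theorem IsEdgeTermFor.polyGenerated (hK : K.Finite) (hfin : ∀ A ∈ K, Finite A.carrier) {k : ℕ}
    {t : Term σ (k + 3)} (ht : IsEdgeTermFor K t) : PolyGenerated K := by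
  obtain ⟨m, hm⟩ := exists_card_le hK
  refine ⟨.X * .C (m * m) + .X * .C (m * m) + ((.X * .C m) ^ (k + 1) + 1),
    fun n A hA S hne hS => ?_⟩
  have hf : ∀ i, ∃ f : (A i).carrier → Fin m, Function.Injective f := fun i => by
    have := hfin _ (hA i)
    exact ⟨_, (Fin.castLE_injective (hm _ (hA i))).comp (Finite.equivFin _).injective⟩
  choose f hf using hf
  obtain ⟨s, hs⟩ := hne
  let P : Fin n × Fin m × Fin m → (UAlgebra.pi A).carrier → (UAlgebra.pi A).carrier → Prop :=
    fun z r r' => (∀ j < z.1, r j = r' j) ∧ f z.1 (r z.1) = z.2.1 ∧ f z.1 (r' z.1) = z.2.2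
  have h1 : ∀ z, ∃ u ∈ S, ∃ u' ∈ S, ∀ r ∈ S, ∀ r' ∈ S, P z r r' → P z u u' := fun z => by
    by_cases h : ∃ r ∈ S, ∃ r' ∈ S, P z r r'
    · obtain ⟨r, hr, r', hr', h⟩ := h
      exact ⟨r, hr, r', hr', fun _ _ _ _ _ => h⟩
    · exact ⟨s, hs, s, hs, fun r hr r' hr' h' => absurd ⟨r, hr, r', hr', h'⟩ h⟩
  choose u hu u' hu' huP using h1
  have h2 : ∀ d : Fin (k + 1) → Fin n × Fin m, ∃ v ∈ S, ∀ r ∈ S,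
      (∀ l, f (d l).1 (r (d l).1) = (d l).2) → ∀ l, f (d l).1 (v (d l).1) = (d l).2 := fun d => by
    by_cases h : ∃ r ∈ S, ∀ l, f (d l).1 (r (d l).1) = (d l).2
    · obtain ⟨r, hr, h⟩ := h
      exact ⟨r, hr, fun _ _ _ => h⟩
    · exact ⟨s, hs, fun r hr h' => absurd ⟨r, hr, h'⟩ h⟩
  choose v hv hvP using h2
  let g : ((Fin n × Fin m × Fin m) ⊕ (Fin n × Fin m × Fin m)) ⊕
      ((Fin (k + 1) → Fin n × Fin m) ⊕ Unit) → (UAlgebra.pi A).carrier :=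
    Sum.elim (Sum.elim u u') (Sum.elim v fun _ => s)
  have hgS : Set.range g ⊆ S := by
    rintro _ ⟨(z | z) | (z | z), rfl⟩
    exacts [hu z, hu' z, hv z, hs]
  have hmem : ∀ z, g z ∈ (UAlgebra.pi A).ClosureSet (Set.range g) := fun z =>
    UAlgebra.subset_closureSet _ _ ⟨z, rfl⟩
  have hsub := UAlgebra.closureSet_subset hS hgS
  refine ⟨Set.range g, hgS, Set.finite_range g, ?_, hsub.antisymm ?_⟩
  · refine (Finite.card_range_le g).trans (le_of_eq ?_)
    simp [Nat.card_eq_fintype_card]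
  · refine ht.subset_of_fork_of_proj hA (UAlgebra.closureSet_isClosed _ _) hsub
      ⟨_, hmem (.inr (.inr ()))⟩ (fun i r hr r' hr' h => ?_) fun r hr c => ?_
    · obtain ⟨h3, h4, h5⟩ := huP (i, f i (r i), f i (r' i)) r hr r' hr' ⟨h, rfl, rfl⟩
      exact ⟨_, hmem (.inl (.inl _)), _, hmem (.inl (.inr _)), h3, hf _ h4, hf _ h5⟩
    · let d : Fin (k + 1) → Fin n × Fin m := fun l => (c l, f _ (r (c l)))
      exact ⟨v d, hmem (.inr (.inl d)), fun l => hf _ (hvP d r hr (fun _ => rfl) l)⟩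

theorem PolyGenerated.fewSubproducts (hK : K.Finite) (hfin : ∀ A ∈ K, Finite A.carrier)
    (h : PolyGenerated K) : FewSubproducts K := by
  obtain ⟨m, hm⟩ := exists_card_le hK
  obtain ⟨p, hp⟩ := h
  refine ⟨(.C m * .X + 1) * p, fun n A hA => ?_⟩
  have : ∀ i, Finite (A i).carrier := fun i => hfin _ (hA i)
  have : Finite (UAlgebra.pi A).carrier := inferInstanceAs (Finite (∀ i, (A i).carrier))
  have h1 : ∀ S : {S : Set (UAlgebra.pi A).carrier // S.Nonempty ∧ (UAlgebra.pi A).IsClosed S},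
      ∃ g : Fin (p.eval n) → Option (UAlgebra.pi A).carrier,
        (UAlgebra.pi A).ClosureSet {a | ∃ i, g i = some a} = S.1 := by
    rintro ⟨S, hne, hS⟩
    obtain ⟨G, -, hGfin, hcard, hG⟩ := hp n A hA S hne hS
    refine ⟨fun i => hGfin.toFinset.toList[i.1]?, ?_⟩
    refine Eq.trans (congrArg _ (Set.ext fun a => ?_)) hG
    rw [Set.mem_ofPred_eq, ← hGfin.mem_toFinset, ← Finset.mem_toList, List.mem_iff_getElem?]
    refine ⟨fun ⟨i, hi⟩ => ⟨i, hi⟩, fun ⟨i, hi⟩ => ⟨⟨i, ?_⟩, hi⟩⟩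
    obtain ⟨hlt, -⟩ := List.getElem?_eq_some_iff.1 hi
    rw [Finset.length_toList, ← Set.ncard_eq_toFinset_card G hGfin] at hlt
    exact hlt.trans_le hcard
  choose g hg using h1
  have hinj : Function.Injective g := fun S S' e => Subtype.ext (by rw [← hg, ← hg, e])
  have hcard : Nat.card (UAlgebra.pi A).carrier ≤ m ^ n := by
    refine (Nat.card_pi (β := fun i => (A i).carrier)).trans_le ?_
    simpa using Finset.prod_le_pow_card Finset.univ _ m fun i _ => hm _ (hA i)
  have hbase : m ^ n + 1 ≤ 2 ^ (m * n + 1) := by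
    have := Nat.pow_le_pow_left (Nat.lt_two_pow_self (n := m)).le n
    rw [← pow_mul] at this
    have := Nat.one_le_two_pow (n := m * n)
    rw [pow_succ]
    omega
  refine (Nat.card_le_card_of_injective g hinj).trans ?_
  rw [Nat.card_fun, Nat.card_fin, Finite.card_option]
  refine (Nat.pow_le_pow_left ((Nat.succ_le_succ hcard).trans hbase) _).trans_eq ?_
  rw [← pow_mul]
  simp

end PolyGenerated

/-- for a finite set of finite idempotent similar algebras,
having few subproducts, having an edge term, and a polynomial bound on
`g_K` are equivalent. -/
theorem stmt_2 (σ : Signature) (K : Set (UAlgebra σ)) (hKfin : K.Finite)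
    (hfin : ∀ A ∈ K, Finite A.carrier) (hne : ∀ A ∈ K, Nonempty A.carrier)
    (hid : ∀ A ∈ K, A.Idempotent) :
    (FewSubproducts K ↔ ∃ (k : ℕ) (t : Term σ (k + 3)), IsEdgeTermFor K t) ∧
    ((∃ (k : ℕ) (t : Term σ (k + 3)), IsEdgeTermFor K t) ↔ PolyGenerated K) := by
  have few_edge := exists_isEdgeTermFor_of_fewSubproducts hKfin hfin hid
  have edge_poly : (∃ (k : ℕ) (t : Term σ (k + 3)), IsEdgeTermFor K t) → PolyGenerated K :=
    fun ⟨_, _, ht⟩ => ht.polyGenerated hKfin hfin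
  have poly_few := PolyGenerated.fewSubproducts hKfin hfin
  exact ⟨⟨few_edge, fun h => poly_few (edge_poly h)⟩, ⟨edge_poly, fun h => few_edge (poly_few h)⟩⟩
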